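/- Let E be a directed graph. Every tail-equivalence class of boundary paths is dense in the boundary path space ∂E if and only if E is cofinal and for every singular vertex v and every vertex w there is a finite path from w to v. -/

import Mathlib

/-! ## Directed graphs, paths, and the boundary path space -/

/-- A directed graph: edge set `E`, vertex set `V`, source and range maps. -/
structure DGraph (V : Type*) (E : Type*) where
  s : E → V
  r : E → V

variable {V E : Type*}

/-- A finite path in a directed graph: a base (source) vertex together with a finite
sequence of composable edges; vertices are the trivial paths. -/
structure FinPath (G : DGraph V E) where
  src : V
  edges : List E
  src_eq : ∀ e ∈ edges.head?, G.s e = src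
  chain : edges.Chain' fun e f => G.r e = G.s f

namespace FinPath

variable {G : DGraph V E}

/-- The range (terminal vertex) of a finite path. -/
def rng (μ : FinPath G) : V := μ.edges.getLast?.elim μ.src G.r

/-- `μ ≤ ν`: `ν` extends `μ`, i.e. `ν = μλ` for some (possibly trivial) path `λ`. -/
def Le (μ ν : FinPath G) : Prop := μ.src = ν.src ∧ μ.edges <+: ν.edges

/-- Two finite paths are disjoint if neither is an initial segment of the other. -/
def Disjoint (μ ν : FinPath G) : Prop := ¬ Le μ ν ∧ ¬ Le ν μ

/-- A cycle: a nontrivial path returning to its base vertex. -/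
def IsCycle (μ : FinPath G) : Prop := μ.edges ≠ [] ∧ μ.rng = μ.src

/-- A return path: a cycle not passing through its base vertex in between. -/
def IsReturnPath (μ : FinPath G) : Prop :=
  IsCycle μ ∧ ∀ (i : ℕ) (h : i + 1 < μ.edges.length),
    G.r (μ.edges.get ⟨i, Nat.lt_of_succ_lt h⟩) ≠ μ.rng

/-- A path has an exit. -/
def HasExit (μ : FinPath G) : Prop :=
  ∃ (i : Fin μ.edges.length) (e : E),
    G.s e = G.s (μ.edges.get i) ∧ e ≠ μ.edges.get i

end FinPath

/-- The trivial path at a vertex. -/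
def trivialPath (G : DGraph V E) (v : V) : FinPath G :=
  ⟨v, [], by intro e he; simp at he, List.IsChain.nil⟩

/-- An infinite path in a directed graph. -/
structure InfPath (G : DGraph V E) where
  edges : ℕ → E
  chain : ∀ i, G.r (edges i) = G.s (edges (i + 1))

/-- The source vertex of an infinite path. -/
def InfPath.src {G : DGraph V E} (x : InfPath G) : V := G.s (x.edges 0)

/-- A wandering infinite path: it visits each vertex only finitely often. -/
def Wandering {G : DGraph V E} (x : InfPath G) : Prop :=
  ∀ v : V, {i : ℕ | G.s (x.edges i) = v}.Finite

/-- A semi-tail: a wandering infinite path each of whose edges is the unique edge emitted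
by its source. -/
def IsSemiTail {G : DGraph V E} (x : InfPath G) : Prop :=
  Wandering x ∧ ∀ i, ∀ e : E, G.s e = G.s (x.edges i) → e = x.edges i

/-- A sink: a vertex emitting no edges. -/
def IsSink (G : DGraph V E) (v : V) : Prop := ∀ e : E, G.s e ≠ v

/-- An infinite emitter. -/
def InfEmitter (G : DGraph V E) (v : V) : Prop := {e : E | G.s e = v}.Infinite

/-- A singular vertex: a sink or an infinite emitter. -/
def Singular (G : DGraph V E) (v : V) : Prop := IsSink G v ∨ InfEmitter G v

/-- `v ≥ w`: there is a finite path from `v` to `w`. -/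
def Reaches (G : DGraph V E) (v w : V) : Prop :=
  ∃ μ : FinPath G, μ.src = v ∧ μ.rng = w

/-- Condition (L): every cycle has an exit. -/
def CondL (G : DGraph V E) : Prop :=
  ∀ μ : FinPath G, μ.IsCycle → μ.HasExit

/-- Condition (T): from every vertex there are at least two distinct paths to some common
vertex. -/
def CondT (G : DGraph V E) : Prop :=
  ∀ v : V, ∃ μ ν : FinPath G, μ ≠ ν ∧ μ.src = v ∧ ν.src = v ∧ μ.rng = ν.rng

/-- Condition (K): every vertex supports either no return path or at least two. -/
def CondK (G : DGraph V E) : Prop :=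
  ∀ v : V, (¬ ∃ μ : FinPath G, μ.IsReturnPath ∧ μ.src = v) ∨
    (∃ μ ν : FinPath G, μ ≠ ν ∧ μ.IsReturnPath ∧ ν.IsReturnPath ∧ μ.src = v ∧ ν.src = v)

/-- Condition (W): every wandering infinite path admits a second route from its source to
the range of one of its edges. -/
def CondW (G : DGraph V E) : Prop :=
  ∀ x : InfPath G, Wandering x →
    ∃ (n : ℕ) (μ ν : FinPath G), μ ≠ ν ∧ μ.src = x.src ∧ ν.src = x.src ∧
      μ.rng = G.r (x.edges n) ∧ ν.rng = G.r (x.edges n)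

/-- Condition (∞): every infinite emitter emits infinitely many edges whose ranges can
reach back. -/
def CondInf (G : DGraph V E) : Prop :=
  ∀ v : V, InfEmitter G v → {e : E | G.s e = v ∧ Reaches G (G.r e) v}.Infinite

/-- Cofinality: every vertex can reach some vertex on every infinite path. -/
def Cofinal (G : DGraph V E) : Prop :=
  ∀ (v : V) (x : InfPath G), ∃ n : ℕ, Reaches G v (G.s (x.edges n))

/-- The boundary path space: all infinite paths together with all finite paths ending at a
singular vertex. -/
def BPath (G : DGraph V E) : Type _ :=
  {μ : FinPath G // Singular G μ.rng} ⊕ InfPath G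

namespace BPath

variable {G : DGraph V E}

/-- The source vertex of a boundary path. -/
def src : BPath G → V
  | Sum.inl p => p.1.src
  | Sum.inr x => x.src

/-- The `n`-th edge of a boundary path (0-indexed), if it exists. -/
def edgeAt : BPath G → ℕ → Option E
  | Sum.inl p, n => p.1.edges[n]?
  | Sum.inr x, n => some (x.edges n)

end BPath

/-- A finite path `μ` is an initial segment of a boundary path `p`. -/
def IsPrefixOf {G : DGraph V E} (μ : FinPath G) (p : BPath G) : Prop :=
  μ.src = p.src ∧ ∀ i, i < μ.edges.length → p.edgeAt i = μ.edges[i]?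

/-- The cylinder set `Z(μ)` of a finite path. -/
def ZSet {G : DGraph V E} (μ : FinPath G) : Set (BPath G) :=
  {p | IsPrefixOf μ p}

/-- The basic set `Z(μ∖F) = Z(μ) ∖ ⋃_{e ∈ F} Z(μe)`. -/
def ZMinus {G : DGraph V E} (μ : FinPath G) (F : Set E) : Set (BPath G) :=
  {p | IsPrefixOf μ p ∧ ∀ e ∈ F, p.edgeAt μ.edges.length ≠ some e}

/-- The topology on the boundary path space generated by the basic sets `Z(μ∖F)`. -/
instance bpathTopology {G : DGraph V E} : TopologicalSpace (BPath G) :=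
  TopologicalSpace.generateFrom
    {S | ∃ (μ : FinPath G) (F : Set E), F.Finite ∧ (∀ e ∈ F, G.s e = μ.rng) ∧ S = ZMinus μ F}

/-- Tail equivalence of boundary paths. -/
def TailEquiv {G : DGraph V E} : BPath G → BPath G → Prop
  | Sum.inl p, Sum.inl q => p.1.rng = q.1.rng
  | Sum.inr x, Sum.inr y => ∃ k l : ℕ, ∀ n : ℕ, x.edges (k + n) = y.edges (l + n)
  | Sum.inl _, Sum.inr _ => False
  | Sum.inr _, Sum.inl _ => False

section Helpers

variable {G : DGraph V E}

/-- Concatenation of finite paths. -/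
def FinPath.app (μ ν : FinPath G) (h : ν.src = μ.rng) : FinPath G where
  src := μ.src
  edges := μ.edges ++ ν.edges
  src_eq := by
    intro e he
    rcases hm : μ.edges with _ | ⟨a, l⟩
    · rw [hm] at he
      have h1 := ν.src_eq e (by simpa using he)
      rw [h1, h]; simp [FinPath.rng, hm]
    · rw [hm] at he
      exact μ.src_eq e (by rw [hm]; simpa using he)
  chain := by
    refine List.isChain_append.2 ⟨μ.chain, ν.chain, ?_⟩
    intro a ha b hb
    rw [ν.src_eq b hb, h]
    rw [Option.mem_def] at ha
    simp [FinPath.rng, ha]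

theorem FinPath.app_rng (μ ν : FinPath G) (h : ν.src = μ.rng) :
    (μ.app ν h).rng = ν.rng := by
  rcases hn : ν.edges.getLast? with _ | a
  · have : ν.edges = [] := by simpa using hn
    have h2 : ν.rng = ν.src := by simp [FinPath.rng, this]
    rw [h2, h]
    simp [FinPath.rng, FinPath.app, this]
  · simp [FinPath.rng, FinPath.app, List.getLast?_append, hn]

/-- The path consisting of a single edge. -/
def edgePath (G : DGraph V E) (e : E) : FinPath G where
  src := G.s e
  edges := [e]
  src_eq := by intro f hf; simp at hf; rw [hf]
  chain := List.isChain_singleton _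

theorem reaches_refl (v : V) : Reaches G v v := ⟨trivialPath G v, rfl, rfl⟩

theorem reaches_edge {v : V} {e : E} (h : Reaches G v (G.s e)) : Reaches G v (G.r e) := by
  obtain ⟨μ, h1, h2⟩ := h
  exact ⟨μ.app (edgePath G e) h2.symm, h1, FinPath.app_rng μ (edgePath G e) h2.symm⟩

/-- Prepend an edge to an infinite path. -/
def InfPath.cons (a : E) (x : InfPath G) (h : G.r a = x.src) : InfPath G where
  edges := fun n => Nat.casesOn n a x.edges
  chain := by
    intro i
    cases i with
    | zero => exact h
    | succ i => exact x.chain i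

/-- Tail of an infinite path. -/
def InfPath.tail (x : InfPath G) (k : ℕ) : InfPath G where
  edges := fun n => x.edges (k + n)
  chain := fun i => x.chain (k + i)

theorem exists_inf_app (l : List E) : (l.IsChain fun e f => G.r e = G.s f) → ∀ x : InfPath G,
    (∀ e ∈ l.getLast?, G.r e = x.src) →
    ∃ y : InfPath G, (∀ i, i < l.length → some (y.edges i) = l[i]?) ∧
      ∀ n, y.edges (l.length + n) = x.edges n := by
  induction l using List.reverseRecOn with
  | nil => intro _ x _; exact ⟨x, by simp, by simp⟩
  | append_singleton l a ih =>
    intro hc x hx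
    rw [List.isChain_append] at hc
    obtain ⟨y, hy1, hy2⟩ := ih hc.1 (x.cons a (hx a (by simp)))
      (fun e he => hc.2.2 e he a (by simp))
    refine ⟨y, ?_, ?_⟩
    · intro i hi
      simp only [List.length_append, List.length_singleton] at hi
      rcases Nat.lt_succ_iff_lt_or_eq.1 hi with h | rfl
      · rw [hy1 i h, List.getElem?_append_left h]
      · have := hy2 0
        simp only [Nat.add_zero] at this
        rw [this]; simp [InfPath.cons]
    · intro n
      have := hy2 (n + 1)
      simp only [List.length_append, List.length_singleton]
      rw [show l.length + 1 + n = l.length + (n + 1) by omega, this]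
      rfl

theorem exists_inf_ext (μ : FinPath G) (x : InfPath G) (h : μ.rng = x.src) :
    ∃ y : InfPath G, IsPrefixOf μ (Sum.inr y : BPath G) ∧
      ∀ n, y.edges (μ.edges.length + n) = x.edges n := by
  obtain ⟨y, h1, h2⟩ := exists_inf_app μ.edges μ.chain x (by
    intro e he
    rw [Option.mem_def] at he
    rw [← h]; simp [FinPath.rng, he])
  refine ⟨y, ⟨?_, fun i hi => h1 i hi⟩, h2⟩
  change μ.src = G.s (y.edges 0)
  rcases hm : μ.edges with _ | ⟨a, l⟩
  · have := h2 0
    simp [hm] at this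
    rw [this]
    change _ = x.src
    rw [← h]; simp [FinPath.rng, hm]
  · have := h1 0 (by simp [hm])
    simp [hm] at this
    rw [this]
    exact (μ.src_eq a (by simp [hm])).symm

theorem app_prefix (μ ν : FinPath G) (h : ν.src = μ.rng) {p : BPath G}
    (hp : IsPrefixOf (μ.app ν h) p) : IsPrefixOf μ p := by
  refine ⟨hp.1, fun i hi => ?_⟩
  rw [hp.2 i (by simp [FinPath.app]; omega)]
  simp [FinPath.app, List.getElem?_append_left hi]

/-- Initial segments of an infinite path. -/
theorem exists_take (x : InfPath G) (n : ℕ) : ∃ μ : FinPath G, μ.src = x.src ∧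
    μ.edges.length = n ∧ (∀ i, i < n → μ.edges[i]? = some (x.edges i)) ∧
    μ.rng = G.s (x.edges n) := by
  induction n with
  | zero => exact ⟨trivialPath G x.src, rfl, rfl, by simp, rfl⟩
  | succ n ih =>
    obtain ⟨μ, h1, h2, h3, h4⟩ := ih
    refine ⟨μ.app (edgePath G (x.edges n)) h4.symm, h1, ?_, ?_, ?_⟩
    · simp [FinPath.app, edgePath, h2]
    · intro i hi
      rcases Nat.lt_succ_iff_lt_or_eq.1 hi with h | rfl
      · simp only [FinPath.app]
        rw [List.getElem?_append_left (by omega), h3 i h]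
      · simp [FinPath.app, edgePath, h2]
    · exact (FinPath.app_rng μ (edgePath G (x.edges n)) h4.symm).trans (x.chain n)

theorem exists_bpath (w : V) : ∃ q : BPath G, q.src = w := by
  by_cases hs : ∃ μ : FinPath G, μ.src = w ∧ Singular G μ.rng
  · obtain ⟨μ, h1, h2⟩ := hs
    exact ⟨Sum.inl ⟨μ, h2⟩, h1⟩
  · have key : ∀ u : {u : V // Reaches G w u}, ∃ e, G.s e = u.1 := by
      rintro ⟨u, μ, h1, rfl⟩
      by_contra hc
      push Not at hc
      exact hs ⟨μ, h1, Or.inl hc⟩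
    choose f hf using key
    let step : {u : V // Reaches G w u} → {u : V // Reaches G w u} := fun u =>
      ⟨G.r (f u), reaches_edge (by rw [hf u]; exact u.2)⟩
    let x : InfPath G := ⟨fun n => f (step^[n] ⟨w, reaches_refl w⟩), by
      intro i
      rw [hf, Function.iterate_succ_apply']⟩
    exact ⟨Sum.inr x, hf _⟩

theorem open_zset (μ : FinPath G) : IsOpen (ZSet μ) := by
  refine TopologicalSpace.isOpen_generateFrom_of_mem ⟨μ, ∅, Set.finite_empty, by simp, ?_⟩
  ext p; simp [ZSet, ZMinus]

theorem nhd_inl (q : {μ : FinPath G // Singular G μ.rng}) (U : Set (BPath G)) (hU : IsOpen U) :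
    (Sum.inl q : BPath G) ∈ U → ∃ F : Set E, F.Finite ∧ ZMinus q.1 F ⊆ U := by
  induction hU with
  | basic S hS =>
    obtain ⟨μ, F, hF, -, rfl⟩ := hS
    rintro ⟨⟨h1, h2⟩, h3⟩
    refine ⟨F, hF, ?_⟩
    rintro p ⟨⟨g1, g2⟩, g3⟩
    change ∀ i, i < μ.edges.length → q.1.edges[i]? = μ.edges[i]? at h2
    change ∀ e ∈ F, q.1.edges[μ.edges.length]? ≠ some e at h3
    have hle : μ.edges.length ≤ q.1.edges.length := by
      by_contra hc
      have := h2 q.1.edges.length (by omega)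
      rw [List.getElem?_eq_none le_rfl, eq_comm, List.getElem?_eq_none_iff] at this
      omega
    refine ⟨⟨h1.trans g1, fun i hi => by rw [g2 i (by omega), h2 i hi]⟩, fun e he => ?_⟩
    rcases hle.lt_or_eq with h | h
    · rw [g2 _ h]; exact h3 e he
    · rw [h]; exact g3 e he
  | univ => exact fun _ => ⟨∅, Set.finite_empty, Set.subset_univ _⟩
  | inter S T _ _ ihS ihT =>
    rintro ⟨a, b⟩
    obtain ⟨F, hF, h1⟩ := ihS a
    obtain ⟨F', hF', h2⟩ := ihT b
    exact ⟨F ∪ F', hF.union hF', fun p hp =>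
      ⟨h1 ⟨hp.1, fun e he => hp.2 e (Or.inl he)⟩, h2 ⟨hp.1, fun e he => hp.2 e (Or.inr he)⟩⟩⟩
  | sUnion S _ ih =>
    rintro ⟨T, hT, hq⟩
    obtain ⟨F, hF, h⟩ := ih T hT hq
    exact ⟨F, hF, h.trans (Set.subset_sUnion_of_mem hT)⟩

theorem nhd_inr (x : InfPath G) (U : Set (BPath G)) (hU : IsOpen U) :
    (Sum.inr x : BPath G) ∈ U → ∃ n : ℕ, ∀ p : BPath G, p.src = x.src →
      (∀ i, i < n → p.edgeAt i = some (x.edges i)) → p ∈ U := by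
  induction hU with
  | basic S hS =>
    obtain ⟨μ, F, hF, -, rfl⟩ := hS
    rintro ⟨⟨h1, h2⟩, h3⟩
    refine ⟨μ.edges.length + 1, fun p hp hp2 => ⟨⟨h1.trans hp.symm, fun i hi => ?_⟩, ?_⟩⟩
    · rw [hp2 i (by omega)]; exact h2 i hi
    · intro e he
      rw [hp2 _ (by omega)]; exact h3 e he
  | univ => exact fun _ => ⟨0, fun _ _ _ => trivial⟩
  | inter S T _ _ ihS ihT =>
    rintro ⟨a, b⟩
    obtain ⟨n, h1⟩ := ihS a
    obtain ⟨m, h2⟩ := ihT b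
    exact ⟨n + m, fun p hp hp2 => ⟨h1 p hp fun i hi => hp2 i (by omega),
      h2 p hp fun i hi => hp2 i (by omega)⟩⟩
  | sUnion S _ ih =>
    rintro ⟨T, hT, hq⟩
    obtain ⟨n, h⟩ := ih T hT hq
    exact ⟨n, fun p hp hp2 => ⟨T, hT, h p hp hp2⟩⟩

/-- The edge of a boundary path following an initial segment starts at its range. -/
theorem next_edge (μ : FinPath G) (p : BPath G) (h : IsPrefixOf μ p) (e : E)
    (he : p.edgeAt μ.edges.length = some e) : G.s e = μ.rng := by
  obtain ⟨h1, h2⟩ := h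
  rcases hl : μ.edges.getLast? with _ | a
  · have hnil : μ.edges = [] := by simpa using hl
    have hr : μ.rng = μ.src := by simp [FinPath.rng, hnil]
    rw [hr, h1]
    rw [hnil] at he
    rcases p with q | x
    · exact q.1.src_eq e (by
        change q.1.edges[0]? = some e at he
        rw [List.head?_eq_getElem?]; exact he)
    · change some (x.edges 0) = some e at he
      rw [← Option.some.inj he]; rfl
  · have hr : μ.rng = G.r a := by simp [FinPath.rng, hl]
    rw [hr]
    rw [List.getLast?_eq_getElem?] at hl
    have hpos : 0 < μ.edges.length := by
      rcases hm : μ.edges with _ | _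
      · simp [hm] at hl
      · simp
    have h3 := h2 (μ.edges.length - 1) (by omega)
    rw [hl] at h3
    obtain ⟨k, hk⟩ : ∃ k, μ.edges.length = k + 1 := ⟨μ.edges.length - 1, by omega⟩
    rw [hk] at he h3
    simp only [Nat.add_sub_cancel] at h3
    rcases p with q | x
    · change q.1.edges[k]? = some a at h3
      change q.1.edges[k + 1]? = some e at he
      obtain ⟨ha, rfl⟩ := List.getElem?_eq_some_iff.1 h3
      obtain ⟨hb, rfl⟩ := List.getElem?_eq_some_iff.1 he
      exact (List.isChain_iff_getElem.1 q.1.chain k hb).symm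
    · change some (x.edges k) = some a at h3
      change some (x.edges (k + 1)) = some e at he
      rw [← Option.some.inj h3, ← Option.some.inj he]
      exact (x.chain k).symm

theorem exists_zset_subset (U : Set (BPath G)) (hU : IsOpen U) (hne : U.Nonempty) :
    ∃ ν : FinPath G, ZSet ν ⊆ U := by
  obtain ⟨q | x, hq⟩ := hne
  · obtain ⟨F, hF, hFU⟩ := nhd_inl q U hU hq
    rcases q.2 with hs | hs
    · refine ⟨q.1, fun p hp => hFU ⟨hp, fun e _ h => ?_⟩⟩
      exact hs e (next_edge q.1 p hp e h)
    · obtain ⟨e, he, heF⟩ := hs.exists_notMem_finite hF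
      refine ⟨q.1.app (edgePath G e) he, fun p hp => hFU ⟨app_prefix _ _ _ hp, ?_⟩⟩
      intro f hf h
      have := hp.2 q.1.edges.length (by simp [FinPath.app, edgePath])
      rw [h] at this
      simp [FinPath.app, edgePath] at this
      exact heF (this ▸ hf)
  · obtain ⟨n, hn⟩ := nhd_inr x U hU hq
    obtain ⟨μ, h1, h2, h3, -⟩ := exists_take x n
    refine ⟨μ, fun p hp => hn p (hp.1.symm.trans h1) fun i hi => ?_⟩
    rw [hp.2 i (by omega), h3 i hi]

theorem meets (hc : Cofinal G) (hs : ∀ v : V, Singular G v → ∀ w : V, Reaches G w v)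
    (p : BPath G) (ν : FinPath G) : ∃ q ∈ ZSet ν, TailEquiv p q := by
  rcases p with p | x
  · obtain ⟨κ, h1, h2⟩ := hs _ p.2 ν.rng
    have hr : (ν.app κ h1).rng = p.1.rng := (FinPath.app_rng _ _ _).trans h2
    refine ⟨Sum.inl ⟨ν.app κ h1, by rw [hr]; exact p.2⟩, ?_, hr.symm⟩
    exact app_prefix ν κ h1 ⟨rfl, fun i _ => rfl⟩
  · obtain ⟨n, κ, h1, h2⟩ := hc ν.rng x
    obtain ⟨y, hy1, hy2⟩ := exists_inf_ext (ν.app κ h1) (x.tail n)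
      ((FinPath.app_rng _ _ _).trans h2)
    exact ⟨Sum.inr y, app_prefix _ _ _ hy1, n, _, fun m => (hy2 m).symm⟩

end Helpers

/-- Every tail-equivalence class of boundary paths is dense in `∂E` if and
only if `E` is cofinal and every vertex reaches every singular vertex. -/
theorem statement7 (G : DGraph V E) :
    (∀ p : BPath G, Dense {q : BPath G | TailEquiv p q}) ↔
      (Cofinal G ∧ ∀ v : V, Singular G v → ∀ w : V, Reaches G w v) := by
  constructor
  · intro h
    have key : ∀ (p : BPath G) (w : V), ∃ q : BPath G, q.src = w ∧ TailEquiv p q := by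
      intro p w
      obtain ⟨q0, hq0⟩ := exists_bpath (G := G) w
      obtain ⟨q, hq, hq2⟩ := (h p).inter_open_nonempty _ (open_zset (trivialPath G w))
        ⟨q0, hq0.symm, by simp [trivialPath]⟩
      exact ⟨q, hq.1.symm, hq2⟩
    refine ⟨fun v x => ?_, fun v hv w => ?_⟩
    · obtain ⟨q | y, h1, h2⟩ := key (Sum.inr x) v
      · exact h2.elim
      · obtain ⟨k, l, hkl⟩ := h2
        obtain ⟨μ, g1, -, -, g2⟩ := exists_take y l
        refine ⟨k, μ, g1.trans h1, ?_⟩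
        rw [g2]
        exact congrArg G.s (hkl 0).symm
    · obtain ⟨q | y, h1, h2⟩ := key (Sum.inl ⟨trivialPath G v, hv⟩) w
      · exact ⟨q.1, h1, Eq.symm h2⟩
      · exact h2.elim
  · rintro ⟨hc, hs⟩ p
    rw [dense_iff_inter_open]
    intro U hU hne
    obtain ⟨ν, hν⟩ := exists_zset_subset U hU hne
    obtain ⟨q, hq, hpq⟩ := meets hc hs p ν
    exact ⟨q, hν hq, hpq⟩
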